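/- arXiv:2604.13700 — 4 statements merged into one kernel-verified Lean document; each statement's English description precedes it below -/
import Mathlib

section
/- Let D be a digraph and b a positive integer, and let D' be the b-blow-up of D. Then c(D') ≤ c(D)·b. -/
/-- A digraph: a finite vertex set together with a set of arcs (no loops). -/
structure FinDigraph (V : Type) [DecidableEq V] where
  verts : Finset V
  arcs : Finset (V × V)
  mem_of_arc : ∀ a ∈ arcs, a.1 ∈ verts ∧ a.2 ∈ verts
  ne_of_arc : ∀ a ∈ arcs, a.1 ≠ a.2

namespace FinDigraph

variable {V : Type} [DecidableEq V]

/-- A directed cycle, represented as the list of its (distinct) vertices: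
at least two vertices, consecutive vertices form arcs, and there is an arc
from the last vertex back to the first. -/
def IsCycle (D : FinDigraph V) (C : List V) : Prop :=
  C.Nodup ∧ 2 ≤ C.length ∧ C.Chain' (fun a b => (a, b) ∈ D.arcs) ∧
    ∀ h : C ≠ [], (C.getLast h, C.head h) ∈ D.arcs

/-- `D` contains a collection of `k` openly disjoint directed cycles through a vertex. -/
def HasOpenCycles (D : FinDigraph V) (k : ℕ) : Prop :=
  ∃ (v : V) (C : Fin k → List V), v ∈ D.verts ∧
    (∀ i, D.IsCycle (C i) ∧ v ∈ C i) ∧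
    ∀ i j, i ≠ j → Disjoint ((C i).toFinset \ {v}) ((C j).toFinset \ {v})

/-- `c(D)`: the largest `k` such that `D` contains `k` openly disjoint cycles through
a vertex. -/
noncomputable def cNum (D : FinDigraph V) : ℕ := sSup {k | D.HasOpenCycles k}

/-- The out-degree of a vertex. -/
def outDeg (D : FinDigraph V) (v : V) : ℕ := (D.arcs.filter fun a => a.1 = v).card

/-- The in-degree of a vertex. -/
def inDeg (D : FinDigraph V) (v : V) : ℕ := (D.arcs.filter fun a => a.2 = v).card

/-- A digraph is `r`-regular if it is nonempty and every vertex has out- and in-degree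
exactly `r`. -/
def IsRegular (D : FinDigraph V) (r : ℕ) : Prop :=
  D.verts.Nonempty ∧ ∀ v ∈ D.verts, D.outDeg v = r ∧ D.inDeg v = r

end FinDigraph

namespace FinDigraph

variable {V : Type} [DecidableEq V]

/-- The `b`-blow-up of `D`: each vertex is replaced by `b` copies, and there is an
arc from `(u,i)` to `(w,j)` if and only if `(u,w)` is an arc of `D`. -/
def blowUp (D : FinDigraph V) (b : ℕ) : FinDigraph (V × Fin b) where
  verts := D.verts ×ˢ Finset.univ
  arcs := ((D.verts ×ˢ (Finset.univ : Finset (Fin b))) ×ˢ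
      (D.verts ×ˢ (Finset.univ : Finset (Fin b)))).filter
      fun p => (p.1.1, p.2.1) ∈ D.arcs
  mem_of_arc := by
    intro a ha
    rw [Finset.mem_filter, Finset.mem_product] at ha
    exact ⟨ha.1.1, ha.1.2⟩
  ne_of_arc := by
    intro a ha h
    rw [Finset.mem_filter] at ha
    exact D.ne_of_arc _ ha.2 (congrArg Prod.fst h)

end FinDigraph

/-- `DiPath E a b W`: the arcs in `E` contain a directed path from `a` to `b` whose set of
(pairwise distinct) vertices is `W`. -/
inductive DiPath {V : Type} [DecidableEq V] (E : Finset (V × V)) : V → V → Finset V → Prop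
  | nil (a : V) : DiPath E a a {a}
  | cons {a b c : V} {W : Finset V} : (a, b) ∈ E → a ∉ W → DiPath E b c W →
      DiPath E a c (insert a W)

namespace DiPath

variable {V : Type} [DecidableEq V] {E : Finset (V × V)} {a b c : V} {W : Finset V}

theorem start_mem (h : DiPath E a b W) : a ∈ W := by
  cases h <;> simp

theorem end_mem (h : DiPath E a b W) : b ∈ W := by
  induction h with
  | nil => simp
  | cons _ _ _ ih => exact Finset.mem_insert_of_mem ih

theorem mono {E' : Finset (V × V)} (hE : E ⊆ E') (h : DiPath E a b W) : DiPath E' a b W := by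
  induction h with
  | nil => exact nil _
  | cons h1 h2 _ ih => exact cons (hE h1) h2 ih

theorem exists_suffix (h : DiPath E a b W) {z : V} (hz : z ∈ W) :
    ∃ W' ⊆ W, DiPath E z b W' := by
  induction h with
  | nil a =>
    obtain rfl := Finset.mem_singleton.1 hz
    exact ⟨_, subset_rfl, nil _⟩
  | @cons a b c W h1 h2 h3 ih =>
    rcases Finset.mem_insert.1 hz with rfl | hz
    · exact ⟨_, subset_rfl, cons h1 h2 h3⟩
    · obtain ⟨W', hW', hp⟩ := ih hz
      exact ⟨W', hW'.trans (Finset.subset_insert _ _), hp⟩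

theorem exists_suffix_erase (h : DiPath E a b W) {z : V} (hz : z ∈ W) (hza : z ≠ a) :
    ∃ W' ⊆ W.erase a, DiPath E z b W' := by
  cases h with
  | nil => simp_all
  | @cons _ _ _ W h1 h2 h3 =>
    rw [Finset.erase_insert h2]
    exact h3.exists_suffix (Finset.mem_of_mem_insert_of_ne hz hza)

theorem exists_prefix_erase (h : DiPath E a b W) {z : V} (hz : z ∈ W) (hzb : z ≠ b) :
    ∃ W' ⊆ W.erase b, DiPath E a z W' := by
  induction h with
  | nil => simp_all
  | @cons a b c W h1 h2 h3 ih =>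
    have hac : a ≠ c := fun h => h2 (h ▸ h3.end_mem)
    by_cases hza : z = a
    · subst hza
      exact ⟨{z}, by simp [hac], nil _⟩
    · obtain ⟨W', hW', hp⟩ := ih (Finset.mem_of_mem_insert_of_ne hz hza) hzb
      refine ⟨insert a W', ?_, cons h1 (fun h => h2 (Finset.mem_of_mem_erase (hW' h))) hp⟩
      rw [Finset.erase_insert_of_ne hac]
      exact Finset.insert_subset_insert _ hW'

theorem exists_cons (hab : (a, b) ∈ E) (h : DiPath E b c W) :
    ∃ W' ⊆ insert a W, DiPath E a c W' := by
  by_cases ha : a ∈ W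
  · obtain ⟨W', hW', hp⟩ := h.exists_suffix ha
    exact ⟨W', hW'.trans (Finset.subset_insert _ _), hp⟩
  · exact ⟨_, subset_rfl, cons hab ha h⟩

theorem exists_trans {W₂ : Finset V} (h : DiPath E a b W) (h₂ : DiPath E b c W₂) :
    ∃ W' ⊆ W ∪ W₂, DiPath E a c W' := by
  induction h with
  | nil => exact ⟨W₂, Finset.subset_union_right, h₂⟩
  | @cons a b d W h1 h2 h3 ih =>
    obtain ⟨W', hW', hp⟩ := ih h₂
    obtain ⟨W'', hW'', hp'⟩ := exists_cons h1 hp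
    refine ⟨W'', hW''.trans ?_, hp'⟩
    rw [Finset.insert_union]
    exact Finset.insert_subset_insert _ hW'

theorem of_insert {x y : V} (h : DiPath (insert (x, y) E) a b W) :
    DiPath E a b W ∨ x ∈ W ∧ y ∈ W := by
  induction h with
  | nil => exact .inl (nil _)
  | @cons a b c W h1 h2 h3 ih =>
    have := h3.start_mem
    rcases ih with ih | ih
    · rcases Finset.mem_insert.1 h1 with h | h
      · right
        simp only [Prod.mk.injEq] at h
        grind
      · exact .inl (cons h h2 ih)
    · right
      grind

theorem exists_prefix_of_insert {x y : V} {X : Finset V} (hx : x ∈ X)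
    (h : DiPath (insert (x, y) E) a b W) {z : V} (hz : z ∈ W) (hzX : z ∈ X) :
    ∃ c ∈ X, ∃ W' ⊆ W, DiPath E a c W' := by
  induction h with
  | nil a =>
    obtain rfl := Finset.mem_singleton.1 hz
    exact ⟨z, hzX, _, subset_rfl, nil _⟩
  | @cons a b c W h1 h2 h3 ih =>
    by_cases ha : a ∈ X
    · exact ⟨a, ha, {a}, by simp, nil _⟩
    · obtain ⟨d, hd, W', hW', hp⟩ := ih (by grind)
      refine ⟨d, hd, insert a W', Finset.insert_subset_insert _ hW',
        cons ?_ (fun h => h2 (hW' h)) hp⟩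
      rcases Finset.mem_insert.1 h1 with h | h
      · simp only [Prod.mk.injEq] at h
        exact absurd (h.1 ▸ hx) ha
      · exact h

theorem exists_suffix_of_insert {x y : V} {Y : Finset V} (hy : y ∈ Y)
    (h : DiPath (insert (x, y) E) a b W) (hW : ∃ z ∈ W, z ∈ Y) :
    ∃ c ∈ Y, ∃ W' ⊆ W, DiPath E c b W' := by
  induction h with
  | nil a =>
    obtain ⟨z, hz, hzY⟩ := hW
    obtain rfl := Finset.mem_singleton.1 hz
    exact ⟨z, hzY, _, subset_rfl, nil _⟩
  | @cons a b c W h1 h2 h3 ih =>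
    by_cases hW' : ∃ w ∈ W, w ∈ Y
    · obtain ⟨d, hd, W', hW', hp⟩ := ih hW'
      exact ⟨d, hd, W', hW'.trans (Finset.subset_insert _ _), hp⟩
    · push Not at hW'
      have haY : a ∈ Y := by grind
      have hyW : y ∉ W := fun h => hW' y h hy
      refine ⟨a, haY, _, subset_rfl, cons (b := b) ?_ h2 ?_⟩
      · rcases Finset.mem_insert.1 h1 with h | h
        · simp only [Prod.mk.injEq] at h
          exact absurd (h.2 ▸ h3.start_mem) hyW
        · exact h
      · exact h3.of_insert.resolve_right fun h => hyW h.2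

theorem exists_prefix_disjoint {S : Finset V} (h : DiPath E a b W)
    (hS : ∀ s ∈ S, s ∈ W → s = b) {z : V} (hz : z ∈ W) (hzS : z ∉ S) :
    ∃ W' ⊆ W, Disjoint W' S ∧ DiPath E a z W' := by
  by_cases hzb : z = b
  · subst hzb
    refine ⟨W, subset_rfl, Finset.disjoint_left.2 fun s hs hsS => ?_, h⟩
    exact hzS (hS s hsS hs ▸ hsS)
  · obtain ⟨W', hW', hp⟩ := h.exists_prefix_erase hz hzb
    refine ⟨W', hW'.trans (Finset.erase_subset _ _),
      Finset.disjoint_left.2 fun s hs hsS => ?_, hp⟩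
    have := Finset.mem_erase.1 (hW' hs)
    exact this.1 (hS s hsS this.2)

theorem exists_suffix_disjoint {S : Finset V} (h : DiPath E a b W)
    (hS : ∀ s ∈ S, s ∈ W → s = a) {z : V} (hz : z ∈ W) (hzS : z ∉ S) :
    ∃ W' ⊆ W, Disjoint W' S ∧ DiPath E z b W' := by
  by_cases hza : z = a
  · subst hza
    refine ⟨W, subset_rfl, Finset.disjoint_left.2 fun s hs hsS => ?_, h⟩
    exact hzS (hS s hsS hs ▸ hsS)
  · obtain ⟨W', hW', hp⟩ := h.exists_suffix_erase hz hza
    refine ⟨W', hW'.trans (Finset.erase_subset _ _),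
      Finset.disjoint_left.2 fun s hs hsS => ?_, hp⟩
    have := Finset.mem_erase.1 (hW' hs)
    exact this.1 (hS s hsS this.2)

theorem exists_list (h : DiPath E a b W) :
    ∃ l : List V, (a :: l).Nodup ∧ (a :: l).IsChain (fun u w => (u, w) ∈ E) ∧
      (a :: l).toFinset = W ∧ (a :: l).getLast (by simp) = b := by
  induction h with
  | nil a => exact ⟨[], by simp⟩
  | @cons a b c W h1 h2 h3 ih =>
    obtain ⟨l, hn, hc, hW, hl⟩ := ih
    refine ⟨b :: l, List.nodup_cons.2 ⟨?_, hn⟩, List.isChain_cons_cons.2 ⟨h1, hc⟩, ?_, ?_⟩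
    · rwa [← List.mem_toFinset, hW]
    · rw [List.toFinset_cons, hW]
    · rw [List.getLast_cons (by simp), hl]

theorem notMem_of_forall_arc {v : V} (hE : ∀ e ∈ E, e.1 ≠ v) (h : DiPath E a b W)
    (hb : b ≠ v) : v ∉ W := by
  induction h with
  | nil => simpa using hb.symm
  | cons h1 _ _ ih =>
    rw [Finset.mem_insert, not_or]
    exact ⟨(hE _ h1).symm, ih hb⟩

/-- `S` meets every directed path from `A` to `B`. -/
def Separates (E : Finset (V × V)) (A B S : Finset V) : Prop :=
  ∀ a ∈ A, ∀ b ∈ B, ∀ W, DiPath E a b W → ∃ s ∈ W, s ∈ S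

/-- There are `k` pairwise disjoint directed paths from `A` to `B`. -/
def Linked (E : Finset (V × V)) (A B : Finset V) (k : ℕ) : Prop :=
  ∃ (I : Finset V) (s t : V → V) (P : V → Finset V), I.card = k ∧
    (∀ i ∈ I, s i ∈ A ∧ t i ∈ B ∧ DiPath E (s i) (t i) (P i)) ∧
    ∀ i ∈ I, ∀ j ∈ I, ∀ z ∈ P i, z ∈ P j → i = j

theorem exists_rightInverse_of_card_eq {I X : Finset V} {f : V → V} (hf : ∀ i ∈ I, f i ∈ X)
    (hinj : ∀ i ∈ I, ∀ j ∈ I, f i = f j → i = j) (hc : I.card = X.card) :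
    ∃ g : V → V, ∀ x ∈ X, g x ∈ I ∧ f (g x) = x := by
  have h := Finset.surjOn_of_injOn_of_card_le f hf (fun i hi j hj => hinj i hi j hj) hc.ge
  have : ∀ x, ∃ i, x ∈ X → i ∈ I ∧ f i = x := fun x => by
    by_cases hx : x ∈ X
    · obtain ⟨i, hi, h⟩ := h hx
      exact ⟨i, fun _ => ⟨hi, h⟩⟩
    · exact ⟨x, fun h => absurd h hx⟩
  choose g hg using this
  exact ⟨g, hg⟩

theorem Linked.index_end {A X : Finset V} (h : Linked E A X X.card) :
    ∃ (s : V → V) (P : V → Finset V), (∀ x ∈ X, s x ∈ A ∧ DiPath E (s x) x (P x)) ∧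
      ∀ i ∈ X, ∀ j ∈ X, ∀ z ∈ P i, z ∈ P j → i = j := by
  obtain ⟨I, s, t, P, hI, hP, hd⟩ := h
  obtain ⟨g, hg⟩ := exists_rightInverse_of_card_eq (f := t) (fun i hi => (hP i hi).2.1)
    (fun i hi j hj hij => hd i hi j hj _ (hP i hi).2.2.end_mem (hij ▸ (hP j hj).2.2.end_mem)) hI
  refine ⟨s ∘ g, P ∘ g, fun x hx => ?_, fun i hi j hj z hzi hzj => ?_⟩
  · have := hP _ (hg x hx).1
    rw [(hg x hx).2] at this
    exact ⟨this.1, this.2.2⟩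
  · rw [← (hg i hi).2, ← (hg j hj).2, hd _ (hg i hi).1 _ (hg j hj).1 z hzi hzj]

theorem Linked.index_start {X B : Finset V} (h : Linked E X B X.card) :
    ∃ (t : V → V) (P : V → Finset V), (∀ x ∈ X, t x ∈ B ∧ DiPath E x (t x) (P x)) ∧
      ∀ i ∈ X, ∀ j ∈ X, ∀ z ∈ P i, z ∈ P j → i = j := by
  obtain ⟨I, s, t, P, hI, hP, hd⟩ := h
  obtain ⟨g, hg⟩ := exists_rightInverse_of_card_eq (f := s) (fun i hi => (hP i hi).1)
    (fun i hi j hj hij =>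
      hd i hi j hj _ (hP i hi).2.2.start_mem (hij ▸ (hP j hj).2.2.start_mem)) hI
  refine ⟨t ∘ g, P ∘ g, fun x hx => ?_, fun i hi j hj z hzi hzj => ?_⟩
  · have := hP _ (hg x hx).1
    rw [(hg x hx).2] at this
    exact this.2
  · rw [← (hg i hi).2, ← (hg j hj).2, hd _ (hg i hi).1 _ (hg j hj).1 z hzi hzj]

theorem Linked.mono {E' : Finset (V × V)} (hE : E ⊆ E') {A B : Finset V} {k : ℕ}
    (h : Linked E A B k) : Linked E' A B k := by
  obtain ⟨I, s, t, P, hI, hP, hd⟩ := h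
  exact ⟨I, s, t, P, hI, fun i hi => ⟨(hP i hi).1, (hP i hi).2.1, (hP i hi).2.2.mono hE⟩, hd⟩

/-- Gluing a linkage into `insert x S` and a linkage out of `insert y S` along the arc `(x, y)`,
where `S` is a separator. -/
theorem Linked.glue {A B S : Finset V} {x y : V} (hS : Separates E A B S)
    (hx : x ∉ S) (hy : y ∉ S)
    (h₁ : Linked E A (insert x S) (insert x S).card)
    (h₂ : Linked E (insert y S) B (insert y S).card) :
    Linked (insert (x, y) E) A B (insert x S).card := by
  obtain ⟨s, P, hP, hPd⟩ := h₁.index_end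
  obtain ⟨t, Q, hQ, hQd⟩ := h₂.index_start
  have cross : ∀ i ∈ insert x S, ∀ j ∈ insert y S, ∀ z ∈ P i, z ∈ Q j →
      z ∈ S ∧ i = z ∧ j = z := by
    intro i hi j hj z hzi hzj
    have hPi : ∀ w ∈ S, w ∈ P i → w = i := fun w hw hwi =>
      have hw' := Finset.mem_insert_of_mem hw
      hPd w hw' i hi w (hP w hw').2.end_mem hwi
    have hQj : ∀ w ∈ S, w ∈ Q j → w = j := fun w hw hwj =>
      have hw' := Finset.mem_insert_of_mem hw
      hQd w hw' j hj w (hQ w hw').2.start_mem hwj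
    by_cases hz : z ∈ S
    · exact ⟨hz, (hPi z hz hzi).symm, (hQj z hz hzj).symm⟩
    · exfalso
      obtain ⟨W₁, -, hd₁, hp₁⟩ := (hP i hi).2.exists_prefix_disjoint hPi hzi hz
      obtain ⟨W₂, -, hd₂, hp₂⟩ := (hQ j hj).2.exists_suffix_disjoint hQj hzj hz
      obtain ⟨W, hW, hp⟩ := hp₁.exists_trans hp₂
      obtain ⟨w, hw, hwS⟩ := hS _ (hP i hi).1 _ (hQ j hj).1 W hp
      exact Finset.disjoint_left.1 (Finset.disjoint_union_left.2 ⟨hd₁, hd₂⟩) (hW hw) hwS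
  let σ : V → V := fun i => if i = x then y else i
  have hσ : ∀ i ∈ insert x S, σ i ∈ insert y S := by grind
  have join : ∀ i, ∃ W, i ∈ insert x S → W ⊆ P i ∪ Q (σ i) ∧
      DiPath (insert (x, y) E) (s i) (t (σ i)) W := by
    intro i
    by_cases hi : i ∈ insert x S
    · have hp := (hP i hi).2.mono (Finset.subset_insert (x, y) E)
      have hq := (hQ _ (hσ i hi)).2.mono (Finset.subset_insert (x, y) E)
      by_cases hix : i = x
      · have hσi : σ i = y := if_pos hix
        rw [hσi] at hq ⊢
        obtain ⟨W, hW, hp'⟩ := exists_cons (a := i) (by simp [hix]) hq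
        obtain ⟨W', hW', hp''⟩ := hp.exists_trans hp'
        refine ⟨W', fun _ => ⟨fun z hz => ?_, hp''⟩⟩
        have := hp.end_mem
        grind
      · have hσi : σ i = i := if_neg hix
        rw [hσi] at hq ⊢
        obtain ⟨W', hW', hp''⟩ := hp.exists_trans hq
        exact ⟨W', fun _ => ⟨hW', hp''⟩⟩
    · exact ⟨∅, fun h => absurd h hi⟩
  choose R hR using join
  refine ⟨insert x S, s, t ∘ σ, R, rfl,
    fun i hi => ⟨(hP i hi).1, (hQ _ (hσ i hi)).1, (hR i hi).2⟩, fun i hi j hj z hzi hzj => ?_⟩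
  have hσinj : σ i = σ j → i = j := by grind
  rcases Finset.mem_union.1 ((hR i hi).1 hzi) with h | h <;>
    rcases Finset.mem_union.1 ((hR j hj).1 hzj) with h' | h'
  · exact hPd i hi j hj z h h'
  · have := cross i hi _ (hσ j hj) z h h'
    grind
  · have := cross j hj _ (hσ i hi) z h' h
    grind
  · exact hσinj (hQd _ (hσ i hi) _ (hσ j hj) z h h')

/-- **Menger's theorem** for directed graphs, for disjoint paths between two vertex sets. -/
theorem menger (E : Finset (V × V)) (A B : Finset V) (k : ℕ)
    (h : ∀ S, Separates E A B S → k ≤ S.card) : Linked E A B k := by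
  induction E using Finset.induction_on generalizing A B with
  | empty =>
    have hsep : Separates ∅ A B (A ∩ B) := by
      intro a ha b hb W hp
      cases hp with
      | nil => exact ⟨a, by simp, Finset.mem_inter.2 ⟨ha, hb⟩⟩
      | cons h => simp at h
    obtain ⟨I, hI, hc⟩ := Finset.exists_subset_card_eq (h _ hsep)
    refine ⟨I, id, id, fun i => {i}, hc, fun i hi => ?_, by simp⟩
    have := Finset.mem_inter.1 (hI hi)
    exact ⟨this.1, this.2, nil i⟩
  | insert e E _ ih =>
    obtain ⟨x, y⟩ := e
    by_cases hL : Linked E A B k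
    · exact hL.mono (Finset.subset_insert _ _)
    obtain ⟨S, hS, hSk⟩ : ∃ S, Separates E A B S ∧ S.card < k := by
      by_contra! hcon
      exact hL (ih A B hcon)
    have hX : Separates (insert (x, y) E) A B (insert x S) := by
      intro a ha b hb W hp
      rcases hp.of_insert with hp | hp
      · obtain ⟨s, hs, hsS⟩ := hS a ha b hb W hp
        exact ⟨s, hs, Finset.mem_insert_of_mem hsS⟩
      · exact ⟨x, hp.1, Finset.mem_insert_self _ _⟩
    have hY : Separates (insert (x, y) E) A B (insert y S) := by
      intro a ha b hb W hp
      rcases hp.of_insert with hp | hp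
      · obtain ⟨s, hs, hsS⟩ := hS a ha b hb W hp
        exact ⟨s, hs, Finset.mem_insert_of_mem hsS⟩
      · exact ⟨y, hp.2, Finset.mem_insert_self _ _⟩
    have hXk := h _ hX
    have hYk := h _ hY
    have hx : x ∉ S := fun hx => by
      rw [Finset.insert_eq_of_mem hx] at hXk
      omega
    have hy : y ∉ S := fun hy => by
      rw [Finset.insert_eq_of_mem hy] at hYk
      omega
    have hXc : (insert x S).card = k := by
      have := Finset.card_insert_of_notMem hx
      omega
    have hYc : (insert y S).card = k := by
      have := Finset.card_insert_of_notMem hy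
      omega
    have h₁ : Linked E A (insert x S) k := ih _ _ fun T hT => h T fun a ha b hb W hp => by
      obtain ⟨z, hz, hzX⟩ := hX a ha b hb W hp
      obtain ⟨c, hc, W', hW', hp'⟩ :=
        hp.exists_prefix_of_insert (Finset.mem_insert_self _ _) hz hzX
      obtain ⟨w, hw, hwT⟩ := hT a ha c hc W' hp'
      exact ⟨w, hW' hw, hwT⟩
    have h₂ : Linked E (insert y S) B k := ih _ _ fun T hT => h T fun a ha b hb W hp => by
      obtain ⟨c, hc, W', hW', hp'⟩ :=
        hp.exists_suffix_of_insert (Finset.mem_insert_self _ _) (hY a ha b hb W hp)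
      obtain ⟨w, hw, hwT⟩ := hT c hc b hb W' hp'
      exact ⟨w, hW' hw, hwT⟩
    have := Linked.glue hS hx hy (hXc ▸ h₁) (hYc ▸ h₂)
    rwa [hXc] at this

end DiPath

namespace FinDigraph

open DiPath

variable {V : Type} [DecidableEq V]

/-- The out-neighbours of `v`. -/
def outNbrs (D : FinDigraph V) (v : V) : Finset V :=
  (D.arcs.filter fun e => e.1 = v).image Prod.snd

/-- The in-neighbours of `v`. -/
def inNbrs (D : FinDigraph V) (v : V) : Finset V :=
  (D.arcs.filter fun e => e.2 = v).image Prod.fst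

/-- The arcs of `D` that avoid `v`. -/
def arcsAvoiding (D : FinDigraph V) (v : V) : Finset (V × V) :=
  D.arcs.filter fun e => e.1 ≠ v ∧ e.2 ≠ v

theorem mem_outNbrs {D : FinDigraph V} {v w : V} : w ∈ D.outNbrs v ↔ (v, w) ∈ D.arcs := by
  simp [outNbrs]

theorem mem_inNbrs {D : FinDigraph V} {v w : V} : w ∈ D.inNbrs v ↔ (w, v) ∈ D.arcs := by
  simp [inNbrs]

theorem ne_of_mem_arcs (D : FinDigraph V) {u w : V} (h : (u, w) ∈ D.arcs) : u ≠ w :=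
  D.ne_of_arc _ h

theorem notMem_of_diPath {D : FinDigraph V} {v a b : V} {W : Finset V}
    (h : DiPath (D.arcsAvoiding v) a b W) (hb : b ∈ D.inNbrs v) : v ∉ W :=
  h.notMem_of_forall_arc (fun _ he => (Finset.mem_filter.1 he).2.1)
    (D.ne_of_mem_arcs (mem_inNbrs.1 hb))

theorem exists_diPath_of_isChain (D : FinDigraph V) (v x : V) (l : List V)
    (hc : (x :: l).IsChain fun a b => (a, b) ∈ D.arcs)
    (hl : ((x :: l).getLast (by simp), v) ∈ D.arcs) :
    (∃ a ∈ D.outNbrs v, ∃ b ∈ D.inNbrs v, ∃ W ⊆ (x :: l).toFinset,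
      DiPath (D.arcsAvoiding v) a b W) ∨
    (x ≠ v ∧ ∃ b ∈ D.inNbrs v, ∃ W ⊆ (x :: l).toFinset, DiPath (D.arcsAvoiding v) x b W) := by
  induction l generalizing x with
  | nil =>
    have hxv : (x, v) ∈ D.arcs := by simpa using hl
    exact .inr ⟨D.ne_of_mem_arcs hxv, x, mem_inNbrs.2 hxv, {x}, by simp, .nil x⟩
  | cons y l ih =>
    rw [List.isChain_cons_cons] at hc
    rw [List.getLast_cons (by simp)] at hl
    have hsub : (y :: l).toFinset ⊆ (x :: y :: l).toFinset := by
      rw [List.toFinset_cons (a := x)]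
      exact Finset.subset_insert _ _
    rcases ih y hc.2 hl with ⟨a, ha, b, hb, W, hW, hp⟩ | ⟨hyv, b, hb, W, hW, hp⟩
    · exact .inl ⟨a, ha, b, hb, W, hW.trans hsub, hp⟩
    · by_cases hxv : x = v
      · subst hxv
        exact .inl ⟨y, mem_outNbrs.2 hc.1, b, hb, W, hW.trans hsub, hp⟩
      · obtain ⟨W', hW', hp'⟩ :=
          exists_cons (Finset.mem_filter.2 ⟨hc.1, hxv, hyv⟩ : (x, y) ∈ D.arcsAvoiding v) hp
        refine .inr ⟨hxv, b, hb, W', hW'.trans ?_, hp'⟩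
        rw [List.toFinset_cons (a := x)]
        exact Finset.insert_subset_insert _ hW

theorem IsCycle.exists_isChain {D : FinDigraph V} {C : List V} (hC : D.IsCycle C) {v : V}
    (hv : v ∈ C) :
    ∃ l, (v :: l).toFinset = C.toFinset ∧ (v :: l).IsChain (fun a b => (a, b) ∈ D.arcs) ∧
      ((v :: l).getLast (by simp), v) ∈ D.arcs := by
  obtain ⟨-, -, hc, hl⟩ := hC
  obtain ⟨l₁, l₂, rfl⟩ := List.append_of_mem hv
  have hl := hl (by simp)
  refine ⟨l₂ ++ l₁, by ext; simp; tauto, ?_, ?_⟩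
  · have hc' := List.isChain_append.1 hc
    rw [← List.cons_append]
    refine List.isChain_append.2 ⟨hc'.2.1, hc'.1, fun x hx y hy => ?_⟩
    cases l₁ with
    | nil => simp at hy
    | cons z l₁ =>
      rw [List.getLast_append_of_ne_nil (by simp) (by simp)] at hl
      rw [List.getLast?_eq_some_getLast (by simp)] at hx
      simp_all
  · rcases List.eq_nil_or_concat l₁ with rfl | ⟨l₁, z, rfl⟩
    · simpa using hl
    · have := (List.isChain_append.1 hc).2.2
      simpa using this

/-- The image in `D` of a cycle through `u` under a homomorphism `f` contains a path avoiding
`f u` from an out-neighbour to an in-neighbour of `f u`. -/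
theorem IsCycle.exists_diPath {U : Type} [DecidableEq U] {D' : FinDigraph U} {D : FinDigraph V}
    (f : U → V) (hf : ∀ a b, (a, b) ∈ D'.arcs → (f a, f b) ∈ D.arcs) {C : List U}
    (hC : D'.IsCycle C) {u : U} (hu : u ∈ C) :
    ∃ a ∈ D.outNbrs (f u), ∃ b ∈ D.inNbrs (f u), ∃ W ⊆ C.toFinset.image f,
      DiPath (D.arcsAvoiding (f u)) a b W := by
  obtain ⟨l, hl, hc, hlast⟩ := hC.exists_isChain hu
  have hW : (f u :: l.map f).toFinset = C.toFinset.image f := by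
    rw [← hl]
    ext
    simp
  rw [← hW]
  refine (D.exists_diPath_of_isChain (f u) (f u) (l.map f) ?_ ?_).resolve_right fun h => h.1 rfl
  · exact (List.isChain_map (l := u :: l) f).2 (hc.imp hf)
  · have := hf _ _ hlast
    rwa [← List.getLast_map (f := f) (by simp)] at this

theorem card_le_of_cycles_meet {k : ℕ} {v : V} {C : Fin k → List V} {T : Finset V}
    (hd : ∀ i j, i ≠ j → Disjoint ((C i).toFinset \ {v}) ((C j).toFinset \ {v}))
    (hT : ∀ i, ∃ x ∈ C i, x ≠ v ∧ x ∈ T) : k ≤ T.card := by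
  choose x hxC hxv hxT using hT
  rw [← Fintype.card_fin k, ← Finset.card_univ]
  refine Finset.card_le_card_of_injOn x (fun i _ => hxT i) fun i _ j _ hij => ?_
  by_contra hne
  have hi : x i ∈ (C i).toFinset \ {v} := by simp [hxC, hxv]
  have hj : x j ∈ (C j).toFinset \ {v} := by simp [hxC, hxv]
  exact Finset.disjoint_left.1 (hd i j hne) hi (hij ▸ hj)

theorem HasOpenCycles.le_card_verts {D : FinDigraph V} {k : ℕ} (h : D.HasOpenCycles k) :
    k ≤ D.verts.card := by
  obtain ⟨v, C, -, hC, hd⟩ := h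
  refine card_le_of_cycles_meet hd fun i => ?_
  obtain ⟨a, ha, b, hb, W, hW, hp⟩ :=
    (hC i).1.exists_diPath (D := D) id (fun _ _ h => h) (hC i).2
  have hav := mem_outNbrs.1 ha
  refine ⟨a, ?_, (D.ne_of_mem_arcs hav).symm, (D.mem_of_arc _ hav).2⟩
  simpa using hW hp.start_mem

theorem HasOpenCycles.le_cNum {D : FinDigraph V} {k : ℕ} (h : D.HasOpenCycles k) : k ≤ D.cNum :=
  le_csSup ⟨D.verts.card, fun _ h => h.le_card_verts⟩ h

theorem hasOpenCycles_of_linked {D : FinDigraph V} {v : V} (hv : v ∈ D.verts) {k : ℕ}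
    (h : Linked (D.arcsAvoiding v) (D.outNbrs v) (D.inNbrs v) k) : D.HasOpenCycles k := by
  obtain ⟨I, s, t, P, hI, hP, hd⟩ := h
  have hlist : ∀ i : I, ∃ C : List V, D.IsCycle C ∧ v ∈ C ∧ C.toFinset \ {v} = P i := by
    intro ⟨i, hi⟩
    obtain ⟨hs, ht, hp⟩ := hP i hi
    have hvP := notMem_of_diPath hp ht
    obtain ⟨l, hn, hc, hl, hlast⟩ := hp.exists_list
    refine ⟨v :: s i :: l, ⟨?_, by simp, ?_, fun _ => ?_⟩, by simp, ?_⟩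
    · rw [List.nodup_cons, ← List.mem_toFinset, hl]
      exact ⟨hvP, hn⟩
    · exact List.isChain_cons_cons.2
        ⟨mem_outNbrs.1 hs, hc.imp fun _ _ h => (Finset.mem_filter.1 h).1⟩
    · rw [List.getLast_cons (by simp), hlast]
      exact mem_inNbrs.1 ht
    · rw [List.toFinset_cons, hl, Finset.insert_sdiff_of_mem _ (by simp),
        Finset.sdiff_singleton_eq_erase, Finset.erase_eq_of_notMem hvP]
  choose C hC hvC hCP using hlist
  let e := I.equivFinOfCardEq hI
  refine ⟨v, fun j => C (e.symm j), hv, fun j => ⟨hC _, hvC _⟩, fun i j hij => ?_⟩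
  rw [hCP, hCP, Finset.disjoint_left]
  intro z hz hz'
  exact hij (e.symm.injective (Subtype.ext (hd _ (e.symm i).2 _ (e.symm j).2 z hz hz')))

theorem exists_separates_card_le_cNum {D : FinDigraph V} {v : V} (hv : v ∈ D.verts) :
    ∃ S, Separates (D.arcsAvoiding v) (D.outNbrs v) (D.inNbrs v) S ∧ S.card ≤ D.cNum := by
  by_contra! h
  have := (hasOpenCycles_of_linked hv (menger _ _ _ (D.cNum + 1) h)).le_cNum
  omega

end FinDigraph

/-- For every digraph `D` and positive integer `b`, the `b`-blow-up
`D'` of `D` satisfies `c(D') ≤ c(D)·b`. -/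
theorem cNum_blowUp_le {V : Type} [DecidableEq V] (D : FinDigraph V) (b : ℕ)
    (hb : 1 ≤ b) :
    (D.blowUp b).cNum ≤ D.cNum * b := by
  refine csSup_le' ?_
  rintro k ⟨⟨v, i₀⟩, C, hv, hC, hd⟩
  obtain ⟨S, hS, hSc⟩ := FinDigraph.exists_separates_card_le_cNum (Finset.mem_product.1 hv).1
  have hk : k ≤ (S ×ˢ (Finset.univ : Finset (Fin b))).card := by
    refine FinDigraph.card_le_of_cycles_meet hd fun i => ?_
    obtain ⟨a, ha, c, hc, W, hW, hp⟩ := (hC i).1.exists_diPath (D := D) Prod.fst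
      (fun _ _ h => by rw [FinDigraph.blowUp, Finset.mem_filter] at h; exact h.2) (hC i).2
    obtain ⟨w, hw, hwS⟩ := hS a ha c hc W hp
    obtain ⟨x, hx, rfl⟩ := Finset.mem_image.1 (hW hw)
    refine ⟨x, List.mem_toFinset.1 hx, ?_, by simp [hwS]⟩
    rintro rfl
    exact FinDigraph.notMem_of_diPath hp hc hw
  calc k ≤ S.card * b := by simpa using hk
    _ ≤ D.cNum * b := Nat.mul_le_mul_right b hSc
end

section
/- Let r be a positive integer and let D be an r-regular digraph. Let (A,B,S) be a partition of V(D) such that no arc of D starts in A and ends in B. Then the number of arcs of D between A∪S and B (counting both directions) is at most 2r|S|, and likewise the number of arcs of D between A and B∪S (counting both directions) is at most 2r|S|. -/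
namespace FinDigraph

variable {V : Type} [DecidableEq V]

/-- `a_D[X,Y]`: the number of arcs of `D` between `X` and `Y`, in either direction. -/
def arcsBetween (D : FinDigraph V) (X Y : Finset V) : ℕ :=
  (D.arcs.filter fun a => (a.1 ∈ X ∧ a.2 ∈ Y) ∨ (a.1 ∈ Y ∧ a.2 ∈ X)).card

end FinDigraph

namespace FinDigraph

variable {V : Type} [DecidableEq V]

/-- The number of arcs starting in a set of vertices of a regular digraph. -/
theorem IsRegular.card_filter_fst_mem {D : FinDigraph V} {r : ℕ} (hreg : D.IsRegular r)
    {X : Finset V} (hX : X ⊆ D.verts) :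
    (D.arcs.filter fun a => a.1 ∈ X).card = r * X.card := by
  rw [Finset.card_eq_sum_card_fiberwise (s := D.arcs.filter fun a => a.1 ∈ X)
    (f := Prod.fst) (t := X)
    (fun a ha => (Finset.mem_filter.mp (Finset.mem_coe.mp ha)).2), mul_comm, ← smul_eq_mul]
  refine Finset.sum_eq_card_nsmul fun v hv => ?_
  rw [← (hreg.2 v (hX hv)).1, outDeg, Finset.filter_filter]
  congr 1
  grind

/-- The number of arcs ending in a set of vertices of a regular digraph. -/
theorem IsRegular.card_filter_snd_mem {D : FinDigraph V} {r : ℕ} (hreg : D.IsRegular r)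
    {X : Finset V} (hX : X ⊆ D.verts) :
    (D.arcs.filter fun a => a.2 ∈ X).card = r * X.card := by
  rw [Finset.card_eq_sum_card_fiberwise (s := D.arcs.filter fun a => a.2 ∈ X)
    (f := Prod.snd) (t := X)
    (fun a ha => (Finset.mem_filter.mp (Finset.mem_coe.mp ha)).2), mul_comm, ← smul_eq_mul]
  refine Finset.sum_eq_card_nsmul fun v hv => ?_
  rw [← (hreg.2 v (hX hv)).2, inDeg, Finset.filter_filter]
  congr 1
  grind

/-- In a regular digraph, as many arcs enter a set of vertices as leave it. -/
theorem IsRegular.card_entering_eq_card_leaving {D : FinDigraph V} {r : ℕ}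
    (hreg : D.IsRegular r) {X : Finset V} (hX : X ⊆ D.verts) :
    (D.arcs.filter fun a => a.2 ∈ X ∧ a.1 ∉ X).card =
      (D.arcs.filter fun a => a.1 ∈ X ∧ a.2 ∉ X).card := by
  have h₁ := Finset.card_filter_add_card_filter_not (s := D.arcs.filter fun a => a.1 ∈ X)
    (fun a => a.2 ∈ X)
  have h₂ := Finset.card_filter_add_card_filter_not (s := D.arcs.filter fun a => a.2 ∈ X)
    (fun a => a.1 ∈ X)
  simp only [Finset.filter_filter] at h₁ h₂
  rw [hreg.card_filter_fst_mem hX] at h₁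
  rw [hreg.card_filter_snd_mem hX] at h₂
  simp only [and_comm (a := _ ∈ X) (b := _ ∈ X)] at h₁ h₂
  have h₃ : (D.arcs.filter fun a => a.1 ∈ X ∧ a.2 ∈ X) =
      D.arcs.filter fun a => a.2 ∈ X ∧ a.1 ∈ X := by
    simp only [and_comm]
  grind

/-- The arcs between `X` and `Y` are among those entering or leaving `Y`, if `X` and `Y` are
disjoint. -/
theorem arcsBetween_le_card_entering_add_card_leaving (D : FinDigraph V) {X Y : Finset V}
    (h : Disjoint X Y) :
    D.arcsBetween X Y ≤ (D.arcs.filter fun a => a.2 ∈ Y ∧ a.1 ∉ Y).card +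
      (D.arcs.filter fun a => a.1 ∈ Y ∧ a.2 ∉ Y).card := by
  have hn : ∀ v ∈ X, v ∉ Y := fun v hv => Finset.disjoint_left.mp h hv
  rw [arcsBetween]
  refine le_trans (Finset.card_le_card fun a ha => ?_) (Finset.card_union_le _ _)
  grind

theorem arcsBetween_comm (D : FinDigraph V) (X Y : Finset V) :
    D.arcsBetween X Y = D.arcsBetween Y X := by
  simp only [arcsBetween, or_comm]

end FinDigraph

/-- Let `D` be an `r`-regular digraph and `(A,B,S)` a partition of
`V(D)` with no arc from `A` to `B`. Then `a_D[A∪S, B] ≤ 2r|S|` and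
`a_D[A, B∪S] ≤ 2r|S|`. -/
theorem arcsBetween_le_of_no_arcs {V : Type} [DecidableEq V]
    (r : ℕ) (hr : 1 ≤ r) (D : FinDigraph V) (hreg : D.IsRegular r)
    (A B S : Finset V) (hpart : A ∪ B ∪ S = D.verts)
    (hAB : Disjoint A B) (hAS : Disjoint A S) (hBS : Disjoint B S)
    (hno : ∀ a ∈ A, ∀ b ∈ B, (a, b) ∉ D.arcs) :
    D.arcsBetween (A ∪ S) B ≤ 2 * r * S.card ∧
    D.arcsBetween A (B ∪ S) ≤ 2 * r * S.card := by
  have hB : B ⊆ D.verts := by grind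
  have hA : A ⊆ D.verts := by grind
  have hS : S ⊆ D.verts := by grind
  constructor
  · have h₁ := D.arcsBetween_le_card_entering_add_card_leaving
      (Finset.disjoint_union_left.mpr ⟨hAB, hBS.symm⟩)
    have h₂ := hreg.card_entering_eq_card_leaving hB
    have h₃ : (D.arcs.filter fun a => a.2 ∈ B ∧ a.1 ∉ B).card ≤ r * S.card := by
      rw [← hreg.card_filter_fst_mem hS]
      refine Finset.card_le_card fun a ha => ?_
      have h₄ := D.mem_of_arc a
      have h₅ := hno a.1
      grind
    linarith
  · rw [D.arcsBetween_comm]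
    have h₁ := D.arcsBetween_le_card_entering_add_card_leaving
      (Finset.disjoint_union_left.mpr ⟨hAB.symm, hAS.symm⟩)
    have h₂ := hreg.card_entering_eq_card_leaving hA
    have h₃ : (D.arcs.filter fun a => a.1 ∈ A ∧ a.2 ∉ A).card ≤ r * S.card := by
      rw [← hreg.card_filter_snd_mem hS]
      refine Finset.card_le_card fun a ha => ?_
      have h₄ := D.mem_of_arc a
      have h₅ := hno a.1
      grind
    linarith
end

section
/- Let D be a digraph, k a positive integer, and L ⊆ V(D) a k-linked set. For each S ⊆ V(D) with |S| < k there is a unique strongly connected component ρ(S) of D − S containing more than half of the vertices of L, and ρ is monotone in the sense of havens: for all S ⊆ S' ⊆ V(D) with |S| ≤ |S'| < k, every vertex of ρ(S') belongs to ρ(S). -/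
namespace FinDigraph

variable {V : Type} [DecidableEq V]

/-- `u` reaches `w` in `D` by a directed path (every vertex reaches itself). -/
def Reaches (D : FinDigraph V) (u w : V) : Prop :=
  Relation.ReflTransGen (fun a b => (a, b) ∈ D.arcs) u w

/-- `D − S`: the subdigraph induced on `V(D) ∖ S`. -/
def deleteVerts (D : FinDigraph V) (S : Finset V) : FinDigraph V where
  verts := D.verts \ S
  arcs := D.arcs.filter fun a => a.1 ∉ S ∧ a.2 ∉ S
  mem_of_arc := by
    intro a ha
    rw [Finset.mem_filter] at ha
    have h := D.mem_of_arc a ha.1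
    simp only [Finset.mem_sdiff]
    exact ⟨⟨h.1, ha.2.1⟩, ⟨h.2, ha.2.2⟩⟩
  ne_of_arc := fun a ha => D.ne_of_arc a (Finset.mem_filter.mp ha).1

/-- `C` is (the vertex set of) a strongly connected component of `D`: a nonempty set
of vertices that are pairwise mutually reachable and maximal with this property. -/
def IsSCC (D : FinDigraph V) (C : Finset V) : Prop :=
  C.Nonempty ∧ C ⊆ D.verts ∧ (∀ u ∈ C, ∀ w ∈ C, D.Reaches u w) ∧
    ∀ u ∈ C, ∀ w ∈ D.verts, D.Reaches u w → D.Reaches w u → w ∈ C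

/-- `L` is a `k`-linked set in `D`: for every `S ⊆ V(D)` with `|S| < k`, some
strongly connected component of `D − S` contains more than half of the vertices
of `L`. -/
def IsLinked (D : FinDigraph V) (k : ℕ) (L : Finset V) : Prop :=
  L ⊆ D.verts ∧ ∀ S : Finset V, S ⊆ D.verts → S.card < k →
    ∃ C : Finset V, (D.deleteVerts S).IsSCC C ∧ L.card < 2 * (L ∩ C).card

end FinDigraph

namespace FinDigraph

variable {V : Type} [DecidableEq V]

/-- Reachability survives when fewer vertices are deleted. -/
theorem Reaches.deleteVerts_mono {D : FinDigraph V} {S T : Finset V} (hST : S ⊆ T) {u w : V}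
    (h : (D.deleteVerts T).Reaches u w) : (D.deleteVerts S).Reaches u w := by
  refine Relation.ReflTransGen.mono (fun a b hab => ?_) u w h
  simp only [deleteVerts, Finset.mem_filter] at hab ⊢
  exact ⟨hab.1, fun ha => hab.2.1 (hST ha), fun hb => hab.2.2 (hST hb)⟩

/-- A strong component of `D − T` that meets a strong component of `D − S`, where `S ⊆ T`,
is contained in it. -/
theorem IsSCC.subset_of_mem {D : FinDigraph V} {S T C C' : Finset V} (hST : S ⊆ T)
    (hC : (D.deleteVerts S).IsSCC C) (hC' : (D.deleteVerts T).IsSCC C') {x : V}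
    (hx : x ∈ C) (hx' : x ∈ C') : C' ⊆ C := fun w hw =>
  hC.2.2.2 x hx w (Finset.sdiff_subset_sdiff (Finset.Subset.refl _) hST (hC'.2.1 hw))
    ((hC'.2.2.1 x hx' w hw).deleteVerts_mono hST) ((hC'.2.2.1 w hw x hx').deleteVerts_mono hST)

end FinDigraph

/-- Two sets that each contain more than half of `L` have a common element. -/
theorem Finset.exists_mem_of_card_lt_two_mul_card_inter {V : Type*} [DecidableEq V]
    {L C C' : Finset V} (h : L.card < 2 * (L ∩ C).card) (h' : L.card < 2 * (L ∩ C').card) :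
    ∃ x ∈ C, x ∈ C' := by
  obtain ⟨x, hx⟩ := Finset.inter_nonempty_of_card_lt_card_add_card
    (Finset.inter_subset_left (s₁ := L) (s₂ := C)) (Finset.inter_subset_left (s₁ := L) (s₂ := C'))
    (by omega)
  simp only [Finset.mem_inter] at hx
  exact ⟨x, hx.1.2, hx.2.2⟩

/-- If `L` is a `k`-linked set in `D`, then for each `S ⊆ V(D)`
with `|S| < k` there is a unique strongly connected component `ρ(S)` of `D − S`
containing more than half of the vertices of `L`, and `ρ` is monotone in the sense
of havens: for `S ⊆ S' ⊆ V(D)` with `|S| ≤ |S'| < k`, every vertex of `ρ(S')`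
belongs to `ρ(S)`. -/
theorem linked_set_gives_haven {V : Type} [DecidableEq V] (D : FinDigraph V)
    (k : ℕ) (hk : 1 ≤ k) (L : Finset V) (hL : D.IsLinked k L) :
    (∀ S : Finset V, S ⊆ D.verts → S.card < k →
      ∃! C : Finset V, (D.deleteVerts S).IsSCC C ∧ L.card < 2 * (L ∩ C).card) ∧
    (∀ S S' : Finset V, S ⊆ S' → S' ⊆ D.verts → S'.card < k →
      ∀ C C' : Finset V,
        ((D.deleteVerts S).IsSCC C ∧ L.card < 2 * (L ∩ C).card) →
        ((D.deleteVerts S').IsSCC C' ∧ L.card < 2 * (L ∩ C').card) →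
        C' ⊆ C) := by
  have mono : ∀ S S' : Finset V, S ⊆ S' → ∀ C C' : Finset V,
      ((D.deleteVerts S).IsSCC C ∧ L.card < 2 * (L ∩ C).card) →
      ((D.deleteVerts S').IsSCC C' ∧ L.card < 2 * (L ∩ C').card) → C' ⊆ C := by
    intro S S' hSS C C' hC hC'
    obtain ⟨x, hx, hx'⟩ := Finset.exists_mem_of_card_lt_two_mul_card_inter hC.2 hC'.2
    exact hC.1.subset_of_mem hSS hC'.1 hx hx'
  refine ⟨fun S hS hSk => ?_, fun S S' hSS _ _ => mono S S' hSS⟩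
  obtain ⟨C, hC⟩ := hL.2 S hS hSk
  exact ⟨C, hC, fun C' hC' => (mono S S subset_rfl C C' hC hC').antisymm
    (mono S S subset_rfl C' C hC' hC)⟩
end

section
/- Let r be a positive integer and g ≥ 2 an integer. Every r-regular digraph D in which every directed cycle has length at least g satisfies v(D) ≥ ⌈(3/22)·r⌉·(g − 1) + 1. -/
/-- `HasWalk R n x y`: there is a walk of length `n` from `x` to `y` along the relation `R`. -/
def HasWalk {V : Type*} (R : V → V → Prop) : ℕ → V → V → Prop
  | 0, x, y => x = y
  | n + 1, x, y => ∃ z, HasWalk R n x z ∧ R z y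

namespace HasWalk

variable {V : Type*} {R : V → V → Prop}

theorem single {x y : V} (h : R x y) : HasWalk R 1 x y := ⟨x, rfl, h⟩

theorem trans {m n : ℕ} {x y z : V} (h₁ : HasWalk R m x y) (h₂ : HasWalk R n y z) :
    HasWalk R (m + n) x z := by
  induction n generalizing z with
  | zero => obtain rfl : y = z := h₂; exact h₁
  | succ n ih =>
    obtain ⟨w, hw, hwz⟩ := h₂
    exact ⟨w, ih hw, hwz⟩

theorem exists_seq {n : ℕ} {x y : V} (h : HasWalk R n x y) :
    ∃ p : ℕ → V, p 0 = x ∧ p n = y ∧ ∀ i < n, R (p i) (p (i + 1)) := by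
  induction n generalizing y with
  | zero => exact ⟨fun _ => x, rfl, h, by simp⟩
  | succ n ih =>
    obtain ⟨w, hw, hwy⟩ := h
    obtain ⟨p, hp0, hpn, hp⟩ := ih hw
    refine ⟨fun i => if i ≤ n then p i else y, by simpa using hp0, by simp, fun i hi => ?_⟩
    rcases Nat.lt_succ_iff_lt_or_eq.mp hi with hi | rfl
    · simpa [hi.le, Nat.succ_le_of_lt hi] using hp i hi
    · simpa [hpn] using hwy

theorem of_seq {p : ℕ → V} {m : ℕ} (i : ℕ) (hp : ∀ j < m, R (p (i + j)) (p (i + j + 1))) :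
    HasWalk R m (p i) (p (i + m)) := by
  induction m with
  | zero => rfl
  | succ m ih => exact ⟨_, ih fun j hj => hp j (by omega), hp m (by omega)⟩

/-- A walk in which arcs `y → z` may be replaced by detours `y → · → v → z` through a fixed
vertex `v` either avoids these detours or splits at its first and last use of `v`. -/
theorem eq_or_exists_detour {R' : V → V → Prop} {v : V}
    (hR' : ∀ x y, R' x y → R x y ∨ HasWalk R 2 x v ∧ R v y) {n : ℕ} {x y : V}
    (h : HasWalk R' n x y) :
    HasWalk R n x y ∨ ∃ a b u z, a + b + 1 ≤ n ∧ HasWalk R a x u ∧ HasWalk R 2 u v ∧ R v z ∧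
      HasWalk R b z y := by
  induction n generalizing y with
  | zero => exact Or.inl h
  | succ n ih =>
    obtain ⟨w, hw, hwy⟩ := h
    rcases ih hw, hR' w y hwy with
      ⟨h₁ | ⟨a, b, u, z, hab, hxu, huv, hvz, hzw⟩, h₂ | ⟨hwv, hvy⟩⟩
    · exact Or.inl ⟨w, h₁, h₂⟩
    · exact Or.inr ⟨n, 0, w, y, by omega, h₁, hwv, hvy, rfl⟩
    · exact Or.inr ⟨a, b + 1, u, z, by omega, hxu, huv, hvz, w, hzw, h₂⟩
    · exact Or.inr ⟨a, 0, u, y, by omega, hxu, huv, hvy, rfl⟩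

end HasWalk

/-- If all out-degrees are at least `r`, then some in-degree is at least `r`. -/
theorem exists_le_card_inNeighbors {V : Type*} {R : V → V → Prop} [DecidableRel R] {r : ℕ}
    {S : Finset V} (hS : S.Nonempty) (hdeg : ∀ x ∈ S, r ≤ (S.filter fun y => R x y).card) :
    ∃ v ∈ S, r ≤ (S.filter fun x => R x v).card := by
  refine Finset.exists_le_of_sum_le hS (f := fun _ => r) ?_
  calc ∑ _v ∈ S, r ≤ ∑ x ∈ S, (S.filter fun y => R x y).card := Finset.sum_le_sum hdeg
    _ = ∑ v ∈ S, (S.filter fun x => R x v).card :=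
      Finset.sum_card_bipartiteAbove_eq_sum_card_bipartiteBelow R

/-- The Chvátal–Szemerédi bound: a relation on a nonempty finite set `S` with all out-degrees at
least `r ≥ 1` and no closed walk of positive length less than `g` satisfies
`g * (r + 1) ≤ 2 * |S|`. -/
theorem mul_succ_le_two_mul_card_of_no_short_closed_walk {V : Type*} {r : ℕ} (hr : 1 ≤ r)
    (g : ℕ) (S : Finset V) (R : V → V → Prop) [DecidableRel R] (hS : S.Nonempty)
    (hdeg : ∀ x ∈ S, r ≤ (S.filter fun y => R x y).card)
    (hg : ∀ x n, 0 < n → n < g → ¬ HasWalk R n x x) :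
    g * (r + 1) ≤ 2 * S.card := by
  classical
  induction g using Nat.strong_induction_on generalizing S R with
  | _ g ih =>
  obtain ⟨v, hvS, hv⟩ := exists_le_card_inNeighbors hS hdeg
  match g, ih, hg with
  | 0, _, _ => simp
  | 1, _, _ =>
    have h₁ := (hdeg v hvS).trans (Finset.card_filter_le _ _)
    have h₂ := hS.card_pos
    omega
  | 2, _, hg =>
    have h₁ : (S.filter fun y => R v y).card < S.card :=
      Finset.card_lt_card (Finset.filter_ssubset.mpr
        ⟨v, hvS, fun h => hg v 1 one_pos one_lt_two (HasWalk.single h)⟩)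
    have h₂ := hdeg v hvS
    omega
  | g + 3, ih, hg =>
    have irrefl : ∀ x, ¬ R x x := fun x h => hg x 1 (by omega) (by omega) (HasWalk.single h)
    have asymm : ∀ x y, R x y → ¬ R y x := fun x y h h' =>
      hg x 2 (by omega) (by omega) ((HasWalk.single h).trans (HasWalk.single h'))
    set T := insert v (S.filter fun x => R x v) with hT
    have hTS : T ⊆ S := Finset.insert_subset hvS (Finset.filter_subset _ _)
    have hTcard : r + 1 ≤ T.card := by
      rw [hT, Finset.card_insert_of_notMem (by simp [irrefl])]
      omega
    have hout : (S.filter fun y => R v y) ⊆ S \ T := by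
      intro y hy
      obtain ⟨hyS, hvy⟩ := Finset.mem_filter.mp hy
      refine Finset.mem_sdiff.mpr ⟨hyS, fun hyT => ?_⟩
      rcases Finset.mem_insert.mp hyT with rfl | h
      · exact irrefl _ hvy
      · exact asymm _ _ hvy (Finset.mem_filter.mp h).2
    have key := ih (g + 1) (by omega) (S \ T) (fun x y => R x y ∨ HasWalk R 2 x v ∧ R v y)
      ?_ ?_ ?_
    · rw [Finset.card_sdiff_of_subset hTS] at key
      have := Finset.card_le_card hTS
      have : (g + 3) * (r + 1) = (g + 1) * (r + 1) + 2 * (r + 1) := by ring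
      omega
    · refine Finset.Nonempty.mono hout (Finset.card_pos.mp ?_)
      exact lt_of_lt_of_le hr (hdeg v hvS)
    · intro x hx
      obtain ⟨hxS, hxT⟩ := Finset.mem_sdiff.mp hx
      by_cases h : ∃ w ∈ T, R x w
      · obtain ⟨w, hwT, hxw⟩ := h
        have hxv : HasWalk R 2 x v := by
          rcases Finset.mem_insert.mp hwT with rfl | hw
          · exact absurd (Finset.mem_insert_of_mem (Finset.mem_filter.mpr ⟨hxS, hxw⟩)) hxT
          · exact (HasWalk.single hxw).trans (HasWalk.single (Finset.mem_filter.mp hw).2)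
        refine (hdeg v hvS).trans (Finset.card_le_card fun y hy => ?_)
        exact Finset.mem_filter.mpr ⟨hout hy, Or.inr ⟨hxv, (Finset.mem_filter.mp hy).2⟩⟩
      · refine (hdeg x hxS).trans (Finset.card_le_card fun y hy => ?_)
        obtain ⟨hyS, hxy⟩ := Finset.mem_filter.mp hy
        exact Finset.mem_filter.mpr
          ⟨Finset.mem_sdiff.mpr ⟨hyS, fun hyT => h ⟨y, hyT, hxy⟩⟩, Or.inl hxy⟩
    · intro x n hn hng hwalk
      rcases hwalk.eq_or_exists_detour (R := R) (v := v) fun _ _ h => h with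
        h | ⟨a, b, u, z, hab, hxu, huv, hvz, hzx⟩
      · exact hg x n hn (by omega) h
      · exact hg z (b + a + 2 + 1) (by omega) (by omega)
          (((hzx.trans hxu).trans huv).trans (HasWalk.single hvz))

namespace FinDigraph

/-- A closed walk of positive length contains a directed cycle that is not longer. -/
theorem exists_isCycle_of_closed_walk {V : Type} [DecidableEq V] (D : FinDigraph V) {n : ℕ}
    (hn : 0 < n) {x : V} (h : HasWalk (fun a b => (a, b) ∈ D.arcs) n x x) :
    ∃ C, D.IsCycle C ∧ C.length ≤ n := by
  induction n using Nat.strong_induction_on generalizing x with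
  | _ n ih =>
  obtain ⟨p, hp0, hpn, hp⟩ := h.exists_seq
  by_cases hinj : ∃ i j, i < j ∧ j < n ∧ p i = p j
  · obtain ⟨i, j, hij, hjn, heq⟩ := hinj
    have hwalk := HasWalk.of_seq (R := fun a b => (a, b) ∈ D.arcs) (p := p) (m := j - i) i
      fun k hk => hp (i + k) (by omega)
    rw [Nat.add_sub_cancel' hij.le, ← heq] at hwalk
    obtain ⟨C, hC, hlen⟩ := ih (j - i) (by omega) (by omega) hwalk
    exact ⟨C, hC, by omega⟩
  · push Not at hinj
    refine ⟨(List.range n).map p, ⟨?_, ?_, ?_, ?_⟩, by simp⟩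
    · refine List.Nodup.map_on (fun i hi j hj heq => ?_) List.nodup_range
      rw [List.mem_range] at hi hj
      by_contra hne
      rcases Nat.lt_or_gt_of_ne hne with hlt | hlt
      · exact hinj i j hlt hj heq
      · exact hinj j i hlt hi heq.symm
    · rw [List.length_map, List.length_range]
      by_contra hlt
      obtain rfl : n = 1 := by omega
      exact D.ne_of_arc _ (hp 0 one_pos) (hp0.trans hpn.symm)
    · refine List.isChain_iff_getElem.mpr fun i hi => ?_
      simp only [List.length_map, List.length_range] at hi
      simpa using hp i (by omega)
    · intro _
      have h := hp (n - 1) (by omega)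
      rw [Nat.sub_add_cancel hn, hpn] at h
      simpa [List.getLast_eq_getElem, List.head_eq_getElem, hp0] using h

theorem card_outNeighbors {V : Type} [DecidableEq V] (D : FinDigraph V) (v : V) :
    (D.verts.filter fun y => (v, y) ∈ D.arcs).card = D.outDeg v := by
  refine Finset.card_bij (fun y _ => (v, y)) ?_ ?_ ?_
  · simp
  · simp
  · rintro ⟨a, b⟩ hab
    obtain ⟨hmem, rfl : a = v⟩ := Finset.mem_filter.mp hab
    exact ⟨b, Finset.mem_filter.mpr ⟨(D.mem_of_arc _ hmem).2, hmem⟩, rfl⟩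

end FinDigraph

/-- Every `r`-regular digraph in which every directed cycle has
length at least `g ≥ 2` satisfies `v(D) ≥ ⌈(3/22)·r⌉·(g − 1) + 1`. -/
theorem regular_digraph_girth_verts_bound {V : Type} [DecidableEq V]
    (r : ℕ) (hr : 1 ≤ r) (g : ℕ) (hg : 2 ≤ g)
    (D : FinDigraph V) (hreg : D.IsRegular r)
    (hgirth : ∀ C : List V, D.IsCycle C → g ≤ C.length) :
    ⌈(3 / 22 : ℚ) * r⌉₊ * (g - 1) + 1 ≤ D.verts.card := by
  have hbound : g * (r + 1) ≤ 2 * D.verts.card := by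
    refine mul_succ_le_two_mul_card_of_no_short_closed_walk hr g D.verts
      (fun a b => (a, b) ∈ D.arcs) hreg.1 (fun x hx => ?_) (fun x n hn hng hwalk => ?_)
    · rw [D.card_outNeighbors, (hreg.2 x hx).1]
    · obtain ⟨C, hC, hlen⟩ := D.exists_isCycle_of_closed_walk hn hwalk
      have := hgirth C hC
      omega
  have hrQ : (0 : ℚ) < r := by exact_mod_cast hr
  set k := ⌈(3 / 22 : ℚ) * r⌉₊ with hk
  have hkpos : 0 < k := Nat.ceil_pos.mpr (by positivity)
  have hklt : 22 * k < 3 * r + 22 := by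
    have h : (k : ℚ) < 3 / 22 * r + 1 := Nat.ceil_lt_add_one (by positivity)
    have h' : (22 * k : ℚ) < 3 * r + 22 := by linarith
    exact_mod_cast h'
  obtain ⟨m, rfl⟩ : ∃ m, g = m + 1 := ⟨g - 1, by omega⟩
  have hmul : (m + 1) * (2 * k) ≤ (m + 1) * (r + 1) := Nat.mul_le_mul_left _ (by omega)
  rw [Nat.add_sub_cancel]
  nlinarith
end
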